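/- Let a, b ≥ 2 be integers and let k ≤ 0 be an integer. Let q be the unique integer with 0 ≤ q < a-1+b and (a-1)(1-k) ≡ q (mod a-1+b). Then |W_k| + |X_k| + (gcd(a-1,b) - 1)·|Y_k| + Σ_{i=1}^{b-2} |Z_{i,k}| equals: gcd(a-1,b) if q = 0; q if 1 ≤ q ≤ min(a-1,b); min(a-1,b) if min(a-1,b) < q ≤ max(a-1,b); and (a-1+b) - q if max(a-1,b) < q ≤ (a-1+b) - 1. -/

import Mathlib

theorem ncard_setOf_of_iff_eq_and {α : Type*} {P : α → Prop} {t : α} {Q : Prop} [Decidable Q]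
    (h : ∀ m, P m ↔ m = t ∧ Q) : ({m | P m}.ncard : ℤ) = if Q then 1 else 0 := by
  simp only [h]
  split_ifs with hQ <;> simp [hQ]

theorem ncard_setOf_of_iff_eq_and_or {α : Type*} {P : α → Prop} {t u : α} (htu : t ≠ u)
    {Q R : Prop} [Decidable Q] [Decidable R] (h : ∀ m, P m ↔ (m = t ∧ Q) ∨ (m = u ∧ R)) :
    ({m | P m}.ncard : ℤ) = (if Q then 1 else 0) + if R then 1 else 0 := by
  simp only [h]
  by_cases hQ : Q <;> by_cases hR : R <;> simp [hQ, hR]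
  have := Set.ncard_pair htu
  rw [Set.insert_def] at this
  simp only [Set.mem_singleton_iff] at this
  simp [this]

/-- Theorem 4.1 (chain type): the combinatorial formula for the rank of
`SH^{2k}` of the Milnor fiber of the dual of `x₁²+x₂²+x₃^a x₄+x₄^b`. -/
theorem chain_rank_formula (a b k q : ℤ) (ha : 2 ≤ a) (hb : 2 ≤ b) (hk : k ≤ 0)
    (hq0 : 0 ≤ q) (hq1 : q < a - 1 + b)
    (hq : (a - 1) * (1 - k) ≡ q [ZMOD (a - 1 + b)]) :
    (({m : ℤ | m ≤ -k ∧ 1 ≤ -(a + b - 1) * m - (a - 1) * k ∧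
          -(a + b - 1) * m - (a - 1) * k ≤ b - 2}.ncard : ℤ) +
      ({m : ℤ | 0 ≤ m ∧ 0 ≤ (a + b - 1) * m + (a - 1) * k ∧
          (a + b - 1) * m + (a - 1) * k ≤ 2 * (a - 1)}.ncard : ℤ) +
      ((Int.gcd (a - 1) b : ℤ) - 1) *
        ({m : ℤ | 0 ≤ m ∧ (a + b - 1) * m = (a - 1) * (1 - k)}.ncard : ℤ) +
      ∑ i ∈ Finset.Icc (1 : ℤ) (b - 2),
        ({m : ℤ | 1 ≤ (a + b - 1) * m + i + (a - 1) * k ∧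
            (a + b - 1) * m + i + (a - 1) * k ≤ a - 2}.ncard : ℤ)) =
      if q = 0 then (Int.gcd (a - 1) b : ℤ)
      else if q ≤ min (a - 1) b then q
      else if q ≤ max (a - 1) b then min (a - 1) b
      else (a - 1 + b) - q := by
  obtain ⟨t, ht⟩ := hq.symm.dvd
  obtain ⟨n, rfl⟩ : ∃ n, a = n + 1 := ⟨a - 1, by ring⟩
  have hn : n + 1 + b - 1 = n + b := by ring
  have hn' : n + 1 - 1 = n := by ring
  have hn'' : n + 1 - 2 = n - 1 := by ring
  rw [hn'] at ht hq1
  simp only [hn, hn', hn'']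
  have hN : 0 < n + b := by omega
  have hnk : n * k ≤ 0 := by nlinarith
  have shift (m : ℤ) : (n + b) * m + n * k = (n + b) * (m - t) + (n - q) := by linarith
  have small {s : ℤ} (h₁ : -(n + b) < (n + b) * s) : 0 ≤ s := by
    by_contra!
    nlinarith
  have big {s c : ℤ} (h₁ : (n + b) * s < (n + b) * (c + 1)) : s ≤ c :=
    Int.lt_add_one_iff.mp (lt_of_mul_lt_mul_left h₁ hN.le)
  have hW (m : ℤ) : (m ≤ -k ∧ 1 ≤ -(n + b) * m - n * k ∧ -(n + b) * m - n * k ≤ b - 2) ↔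
      m = t ∧ (n + 1 ≤ q ∧ q ≤ n + b - 2) := by
    have e : -(n + b) * m - n * k = -((n + b) * (m - t) + (n - q)) := by linarith [shift m]
    constructor
    · rintro ⟨-, h₁, h₂⟩
      rw [e] at h₁ h₂
      have h₃ := small (s := m - t) (by linarith)
      have h₄ := big (s := m - t) (c := 0) (by linarith)
      obtain rfl : m = t := by omega
      rw [sub_self, mul_zero] at h₁ h₂
      omega
    · rintro ⟨rfl, h₁, h₂⟩
      refine ⟨?_, ?_, ?_⟩
      · rw [sub_self, mul_zero] at e
        by_contra!
        nlinarith
      · rw [e, sub_self, mul_zero]; omega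
      · rw [e, sub_self, mul_zero]; omega
  have hX (m : ℤ) : (0 ≤ m ∧ 0 ≤ (n + b) * m + n * k ∧ (n + b) * m + n * k ≤ 2 * n) ↔
      (m = t ∧ q ≤ n) ∨ (m = t + 1 ∧ b ≤ q) := by
    constructor
    · rintro ⟨-, h₁, h₂⟩
      rw [shift] at h₁ h₂
      have h₃ := small (s := m - t) (by linarith)
      have h₄ := big (s := m - t) (c := 1) (by linarith)
      obtain h | h : m - t = 0 ∨ m - t = 1 := by omega
      all_goals rw [h] at h₁ h₂; omega
    · intro h
      have h₁ : 0 ≤ (n + b) * m + n * k ∧ (n + b) * m + n * k ≤ 2 * n := by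
        rw [shift]
        rcases h with ⟨rfl, h⟩ | ⟨rfl, h⟩
        · rw [sub_self, mul_zero]; omega
        · rw [add_sub_cancel_left, mul_one]; omega
      exact ⟨small (by linarith), h₁⟩
  have hY (m : ℤ) : (0 ≤ m ∧ (n + b) * m = n * (1 - k)) ↔ m = t ∧ q = 0 := by
    constructor
    · rintro ⟨-, h⟩
      have e : (n + b) * (m - t) = q := by linarith [shift m]
      have h₃ := small (s := m - t) (by linarith)
      have h₄ := big (s := m - t) (c := 0) (by linarith)
      obtain rfl : m = t := by omega
      simp_all
    · rintro ⟨rfl, rfl⟩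
      exact ⟨small (by linarith), by linarith⟩
  have hZ (i : ℤ) (hi : i ∈ Finset.Icc 1 (b - 2)) (m : ℤ) :
      (1 ≤ (n + b) * m + i + n * k ∧ (n + b) * m + i + n * k ≤ n - 1) ↔
        m = t ∧ (q - n + 1 ≤ i ∧ i ≤ q - 1) := by
    rw [Finset.mem_Icc] at hi
    have e : (n + b) * m + i + n * k = (n + b) * (m - t) + (n - q + i) := by linarith [shift m]
    rw [e]
    constructor
    · rintro ⟨h₁, h₂⟩
      have h₃ := small (s := m - t) (by linarith)
      have h₄ := big (s := m - t) (c := 0) (by linarith)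
      obtain rfl : m = t := by omega
      rw [sub_self, mul_zero] at h₁ h₂
      omega
    · rintro ⟨rfl, h₁, h₂⟩
      rw [sub_self, mul_zero]
      omega
  have hsum : (Finset.Icc 1 (b - 2)).filter (fun i => q - n + 1 ≤ i ∧ i ≤ q - 1) =
      Finset.Icc (max 1 (q - n + 1)) (min (b - 2) (q - 1)) := by
    ext i
    simp only [Finset.mem_filter, Finset.mem_Icc]
    omega
  rw [ncard_setOf_of_iff_eq_and hW, ncard_setOf_of_iff_eq_and_or (by omega) hX,
    ncard_setOf_of_iff_eq_and hY,
    Finset.sum_congr rfl fun i hi => ncard_setOf_of_iff_eq_and (hZ i hi),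
    Finset.sum_boole, hsum, Int.card_Icc]
  by_cases hq' : q = 0
  · simp only [hq', if_true, mul_one]
    split_ifs <;> omega
  · simp only [hq', if_false, mul_zero]
    split_ifs <;> omega
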